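/- arXiv:2601.12793 — 2 statements merged into one kernel-verified Lean document; each statement's English description precedes it below -/
import Mathlib

section
/- Fix Δt > 0, an integer N ≥ 2, and T > 0 with N·Δt ≤ T, and set t^k := k·Δt, t^{k±1/2} := (k ± 1/2)·Δt. Let E be a real Banach space, let u : ℝ → E be five times continuously differentiable, and for each n with 1 ≤ n ≤ N − 1 define R^n := (1/Δt)·[ ∫_{t^{n−1/2}}^{t^n} ((t^{n−1/2} − s)⁴/24)·u⁽⁵⁾(s) ds + ∫_{t^n}^{t^{n+1/2}} ((t^{n+1/2} − s)⁴/24)·u⁽⁵⁾(s) ds ]. Then ∑_{n=1}^{N−1} ‖R^n‖² ≤ (Δt⁷/5184) · ∫_0^T ‖u⁽⁵⁾(s)‖² ds. -/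
open MeasureTheory intervalIntegral Finset

/-- Cauchy–Schwarz for a continuous function against the constant `1` on an interval. -/
lemma sq_intervalIntegral_le_mul_intervalIntegral_sq {g : ℝ → ℝ} (hg : Continuous g) {a b : ℝ}
    (hab : a < b) : (∫ s in a..b, g s) ^ 2 ≤ (b - a) * ∫ s in a..b, g s ^ 2 := by
  have hL : 0 < b - a := sub_pos.2 hab
  set I := ∫ s in a..b, g s with hI
  have h0 : 0 ≤ ∫ s in a..b, ((b - a) * g s - I) ^ 2 :=
    intervalIntegral.integral_nonneg hab.le fun s _ => sq_nonneg _
  have h1 : ∫ s in a..b, ((b - a) * g s - I) ^ 2 =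
      (b - a) ^ 2 * (∫ s in a..b, g s ^ 2) - 2 * (b - a) * I * I + (b - a) * I ^ 2 := by
    have he : ∀ s, ((b - a) * g s - I) ^ 2 =
        (b - a) ^ 2 * g s ^ 2 - 2 * (b - a) * I * g s + I ^ 2 := fun s => by ring
    simp_rw [he]
    rw [intervalIntegral.integral_add, intervalIntegral.integral_sub,
      intervalIntegral.integral_const_mul, intervalIntegral.integral_const_mul,
      intervalIntegral.integral_const, smul_eq_mul]
    all_goals exact Continuous.intervalIntegrable (by fun_prop) _ _
  rw [h1] at h0
  refine le_of_mul_le_mul_left ?_ hL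
  nlinarith

/-- An integral with scalar weight bounded by `C` has norm at most `C` times the integral of the
norm. -/
lemma norm_intervalIntegral_smul_le {E : Type*} [NormedAddCommGroup E] [NormedSpace ℝ E]
    {w : ℝ → ℝ} {v : ℝ → E} (hv : Continuous v) {a b C : ℝ} (hab : a ≤ b)
    (hC : ∀ s ∈ Set.Icc a b, |w s| ≤ C) :
    ‖∫ s in a..b, w s • v s‖ ≤ C * ∫ s in a..b, ‖v s‖ := by
  rw [← intervalIntegral.integral_const_mul]
  refine intervalIntegral.norm_integral_le_of_norm_le hab (ae_of_all _ fun s hs => ?_)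
    (Continuous.intervalIntegrable (by fun_prop) _ _)
  rw [norm_smul, Real.norm_eq_abs]
  gcongr
  exact hC s (Set.Ioc_subset_Icc_self hs)

/-- The quartic Taylor weight is at most `d ^ 4 / 24` at distance at most `d`. -/
lemma abs_sub_pow_four_div_le {c s d : ℝ} (h : |c - s| ≤ d) :
    |(c - s) ^ 4 / 24| ≤ d ^ 4 / 24 := by
  rw [abs_div, abs_pow, abs_of_pos (by norm_num : (0 : ℝ) < 24)]
  gcongr

/-- Bound on a single squared remainder by the squared norm on its own cell. -/
lemma half_step_remainder_sq_bound {E : Type*} [NormedAddCommGroup E] [NormedSpace ℝ E]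
    {h : ℝ} (hh : 0 < h) (x : ℝ) {v : ℝ → E} (hv : Continuous v) :
    ‖h⁻¹ • ((∫ s in ((x - 1 / 2) * h)..(x * h), (((x - 1 / 2) * h - s) ^ 4 / 24) • v s) +
        ∫ s in (x * h)..((x + 1 / 2) * h), (((x + 1 / 2) * h - s) ^ 4 / 24) • v s)‖ ^ 2 ≤
      (h ^ 7 / 5184) * ∫ s in ((x - 1 / 2) * h)..((x + 1 / 2) * h), ‖v s‖ ^ 2 := by
  have hleft := norm_intervalIntegral_smul_le (w := fun s => ((x - 1 / 2) * h - s) ^ 4 / 24)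
    (a := (x - 1 / 2) * h) (b := x * h) hv (by nlinarith) fun s hs =>
    abs_sub_pow_four_div_le (d := h / 2) (abs_le.2 ⟨by linarith [hs.2], by linarith [hs.1]⟩)
  have hright := norm_intervalIntegral_smul_le (w := fun s => ((x + 1 / 2) * h - s) ^ 4 / 24)
    (a := x * h) (b := (x + 1 / 2) * h) hv (by nlinarith) fun s hs =>
    abs_sub_pow_four_div_le (d := h / 2) (abs_le.2 ⟨by linarith [hs.2], by linarith [hs.1]⟩)
  have hadd := integral_add_adjacent_intervals (μ := volume)
    (hv.norm.intervalIntegrable ((x - 1 / 2) * h) (x * h))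
    (hv.norm.intervalIntegrable (x * h) ((x + 1 / 2) * h))
  have hcs := sq_intervalIntegral_le_mul_intervalIntegral_sq hv.norm
    (a := (x - 1 / 2) * h) (b := (x + 1 / 2) * h) (by nlinarith)
  rw [show (x + 1 / 2) * h - (x - 1 / 2) * h = h by ring] at hcs
  have hJ : 0 ≤ ∫ s in ((x - 1 / 2) * h)..((x + 1 / 2) * h), ‖v s‖ ^ 2 :=
    intervalIntegral.integral_nonneg (by nlinarith) fun s _ => sq_nonneg _
  have hnorm := (norm_add_le _ _).trans (add_le_add hleft hright)
  rw [← mul_add, hadd] at hnorm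
  rw [norm_smul, norm_inv, Real.norm_of_nonneg hh.le, mul_pow]
  calc _ ≤ h⁻¹ ^ 2 * ((h / 2) ^ 4 / 24 *
        ∫ s in ((x - 1 / 2) * h)..((x + 1 / 2) * h), ‖v s‖) ^ 2 := by gcongr
    _ = h ^ 6 / 147456 * (∫ s in ((x - 1 / 2) * h)..((x + 1 / 2) * h), ‖v s‖) ^ 2 := by
        generalize ∫ s in ((x - 1 / 2) * h)..((x + 1 / 2) * h), ‖v s‖ = I
        field_simp
        ring
    _ ≤ h ^ 6 / 147456 * (h * ∫ s in ((x - 1 / 2) * h)..((x + 1 / 2) * h), ‖v s‖ ^ 2) := by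
        gcongr
    _ = h ^ 7 / 147456 * ∫ s in ((x - 1 / 2) * h)..((x + 1 / 2) * h), ‖v s‖ ^ 2 := by ring
    _ ≤ _ := by gcongr; norm_num

/-- Summed bound on the squared norms of the fifth-order Taylor remainders of the
centered half-step difference quotients. -/
theorem half_step_remainder_sq_sum_bound
    {E : Type*} [NormedAddCommGroup E] [NormedSpace ℝ E] [CompleteSpace E]
    (Δt T : ℝ) (hΔt : 0 < Δt) (hT : 0 < T) (N : ℕ) (hN : 2 ≤ N)
    (hNT : (N : ℝ) * Δt ≤ T)
    (u : ℝ → E) (hu : ContDiff ℝ 5 u) :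
    ∑ n ∈ Finset.Icc 1 (N - 1),
      ‖Δt⁻¹ • ((∫ s in (((n : ℝ) - 1 / 2) * Δt)..((n : ℝ) * Δt),
            ((((n : ℝ) - 1 / 2) * Δt - s) ^ 4 / 24) • iteratedDeriv 5 u s) +
          ∫ s in ((n : ℝ) * Δt)..(((n : ℝ) + 1 / 2) * Δt),
            ((((n : ℝ) + 1 / 2) * Δt - s) ^ 4 / 24) • iteratedDeriv 5 u s)‖ ^ 2 ≤
      (Δt ^ 7 / 5184) * ∫ s in (0 : ℝ)..T, ‖iteratedDeriv 5 u s‖ ^ 2 := by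
  have hv : Continuous (iteratedDeriv 5 u) := hu.continuous_iteratedDeriv 5 le_rfl
  have hv_sq (a b : ℝ) : IntervalIntegrable (fun s => ‖iteratedDeriv 5 u s‖ ^ 2) volume a b :=
    (hv.norm.pow 2).intervalIntegrable a b
  refine (Finset.sum_le_sum fun (n : ℕ) _ =>
    half_step_remainder_sq_bound hΔt (n : ℝ) hv).trans ?_
  rw [← Finset.mul_sum]
  have hIcc : Finset.Icc 1 (N - 1) = Finset.Ico 1 N := by
    ext n
    simp only [Finset.mem_Icc, Finset.mem_Ico]
    omega
  have htel := sum_integral_adjacent_intervals_Ico (μ := volume)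
    (a := fun n : ℕ => ((n : ℝ) - 1 / 2) * Δt) (show 1 ≤ N by omega)
    fun n _ => hv_sq (((n : ℝ) - 1 / 2) * Δt) (((n + 1 : ℕ) - 1 / 2) * Δt)
  have hnode (n : ℕ) : (((n + 1 : ℕ) : ℝ) - 1 / 2) * Δt = ((n : ℝ) + 1 / 2) * Δt := by
    push_cast
    ring
  simp only [hnode] at htel
  have hN' : (2 : ℝ) ≤ N := by exact_mod_cast hN
  rw [hIcc, htel]
  gcongr
  refine integral_mono_interval ?_ ?_ ?_ (ae_of_all _ fun s => sq_nonneg _) (hv_sq 0 T)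
  · push_cast
    linarith
  · push_cast
    nlinarith
  · linarith
end

section
/- Fix Δt > 0 and an integer n ≥ 1, and set t^k := k·Δt. Let E be a real Banach space, let u : ℝ → E be four times continuously differentiable, and define r^n := (1/Δt²)·[ −∫_{t^{n−1}}^{t^n} ((t^{n−1} − s)³/6)·u⁽⁴⁾(s) ds + ∫_{t^n}^{t^{n+1}} ((t^{n+1} − s)³/6)·u⁽⁴⁾(s) ds ]. Then ‖r^n‖² ≤ (Δt³/126) · ∫_{t^{n−1}}^{t^{n+1}} ‖u⁽⁴⁾(s)‖² ds. -/
open MeasureTheory intervalIntegral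

/-- Cauchy–Schwarz inequality for the interval integral of a continuous vector-valued function
against a continuous real weight. -/
theorem sq_norm_integral_smul_le {E : Type*} [NormedAddCommGroup E] [NormedSpace ℝ E]
    {a b : ℝ} (hab : a ≤ b) {k : ℝ → ℝ} {f : ℝ → E} (hk : Continuous k) (hf : Continuous f) :
    ‖∫ s in a..b, k s • f s‖ ^ 2 ≤ (∫ s in a..b, k s ^ 2) * ∫ s in a..b, ‖f s‖ ^ 2 := by
  have norm_le : ‖∫ s in a..b, k s • f s‖ ≤ ∫ s in a..b, |k s| * ‖f s‖ := by
    simpa [norm_smul] using norm_integral_le_integral_norm (f := fun s ↦ k s • f s) hab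
  have quadratic_nonneg (x : ℝ) : 0 ≤ (∫ s in a..b, k s ^ 2) * (x * x) +
      (-2 * ∫ s in a..b, |k s| * ‖f s‖) * x + ∫ s in a..b, ‖f s‖ ^ 2 := by
    have expand : (∫ s in a..b, (x * |k s| - ‖f s‖) ^ 2) = (∫ s in a..b, k s ^ 2) * (x * x) +
        (-2 * ∫ s in a..b, |k s| * ‖f s‖) * x + ∫ s in a..b, ‖f s‖ ^ 2 := by
      have pointwise : (fun s ↦ (x * |k s| - ‖f s‖) ^ 2) = fun s ↦
          (x * x) * k s ^ 2 + (-2 * x) * (|k s| * ‖f s‖) + ‖f s‖ ^ 2 := by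
        funext s
        rw [← sq_abs (k s)]
        ring
      rw [pointwise, intervalIntegral.integral_add, intervalIntegral.integral_add,
        intervalIntegral.integral_const_mul, intervalIntegral.integral_const_mul]
      · ring
      all_goals exact Continuous.intervalIntegrable (by fun_prop) _ _
    rw [← expand]
    exact intervalIntegral.integral_nonneg hab fun s _ ↦ sq_nonneg _
  have discrim_nonpos := discrim_le_zero quadratic_nonneg
  rw [discrim] at discrim_nonpos
  have := pow_le_pow_left₀ (norm_nonneg _) norm_le 2
  linarith

theorem integral_sub_left_pow_three_div_six_sq (a b c : ℝ) :
    ∫ s in a..b, ((c - s) ^ 3 / 6) ^ 2 = ((c - a) ^ 7 - (c - b) ^ 7) / 252 := by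
  have pointwise : (fun s : ℝ ↦ ((c - s) ^ 3 / 6) ^ 2) = fun s ↦ (c - s) ^ 6 / 36 := by
    funext s
    ring
  rw [pointwise, intervalIntegral.integral_div, integral_comp_sub_left (fun s ↦ s ^ 6), integral_pow]
  norm_num
  ring

/-- Bound on the squared norm of the Taylor remainder of the central second
difference quotient. -/
theorem central_second_difference_remainder_sq_bound
    {E : Type*} [NormedAddCommGroup E] [NormedSpace ℝ E] [CompleteSpace E]
    (Δt : ℝ) (hΔt : 0 < Δt) (n : ℕ) (hn : 1 ≤ n)
    (u : ℝ → E) (hu : ContDiff ℝ 4 u) :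
    ‖(Δt ^ 2)⁻¹ • (-(∫ s in (((n : ℝ) - 1) * Δt)..((n : ℝ) * Δt),
          ((((n : ℝ) - 1) * Δt - s) ^ 3 / 6) • iteratedDeriv 4 u s) +
        ∫ s in ((n : ℝ) * Δt)..(((n : ℝ) + 1) * Δt),
          ((((n : ℝ) + 1) * Δt - s) ^ 3 / 6) • iteratedDeriv 4 u s)‖ ^ 2 ≤
      (Δt ^ 3 / 126) *
        ∫ s in (((n : ℝ) - 1) * Δt)..(((n : ℝ) + 1) * Δt),
          ‖iteratedDeriv 4 u s‖ ^ 2 := by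
  have hf : Continuous (iteratedDeriv 4 u) := hu.continuous_iteratedDeriv' 4
  generalize iteratedDeriv 4 u = f at hf ⊢
  have hg (a b : ℝ) : IntervalIntegrable (fun s ↦ ‖f s‖ ^ 2) volume a b :=
    (hf.norm.pow 2).intervalIntegrable a b
  have left := sq_norm_integral_smul_le (a := ((n : ℝ) - 1) * Δt) (b := n * Δt) (by linarith)
    (k := fun s ↦ (((n : ℝ) - 1) * Δt - s) ^ 3 / 6) (by fun_prop) hf
  have right := sq_norm_integral_smul_le (a := n * Δt) (b := ((n : ℝ) + 1) * Δt) (by linarith)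
    (k := fun s ↦ (((n : ℝ) + 1) * Δt - s) ^ 3 / 6) (by fun_prop) hf
  rw [integral_sub_left_pow_three_div_six_sq] at left right
  rw [← integral_add_adjacent_intervals (hg _ ((n : ℝ) * Δt)) (hg _ _)]
  set I := ∫ s in (((n : ℝ) - 1) * Δt)..(n * Δt), ((((n : ℝ) - 1) * Δt - s) ^ 3 / 6) • f s
  set J := ∫ s in (n * Δt)..(((n : ℝ) + 1) * Δt), ((((n : ℝ) + 1) * Δt - s) ^ 3 / 6) • f s
  set G := ∫ s in (((n : ℝ) - 1) * Δt)..(n * Δt), ‖f s‖ ^ 2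
  set H := ∫ s in (n * Δt)..(((n : ℝ) + 1) * Δt), ‖f s‖ ^ 2
  have left' : ‖I‖ ^ 2 ≤ Δt ^ 7 / 252 * G := left.trans_eq (by ring)
  have right' : ‖J‖ ^ 2 ≤ Δt ^ 7 / 252 * H := right.trans_eq (by ring)
  have sum_le : ‖-I + J‖ ^ 2 ≤ Δt ^ 7 / 126 * (G + H) := by
    have triangle : ‖-I + J‖ ≤ ‖I‖ + ‖J‖ := by simpa using norm_add_le (-I) J
    have := pow_le_pow_left₀ (norm_nonneg _) triangle 2
    linarith [add_sq_le (a := ‖I‖) (b := ‖J‖)]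
  calc ‖(Δt ^ 2)⁻¹ • (-I + J)‖ ^ 2 = ((Δt ^ 2)⁻¹) ^ 2 * ‖-I + J‖ ^ 2 := by
        rw [norm_smul, mul_pow, Real.norm_eq_abs, sq_abs]
    _ ≤ ((Δt ^ 2)⁻¹) ^ 2 * (Δt ^ 7 / 126 * (G + H)) := by gcongr
    _ = Δt ^ 3 / 126 * (G + H) := by field_simp
end
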